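/- Let Z be an asymmetric partition with representation Z', and let A°_{Z'} = {X ∈ 𝒳 : ‖X − Z'‖ < α_Z/4}. If X' ∈ A°_{Z'} and Y' ∈ A°_{Z'}, then X' is the unique representation of the partition π(X') that is in optimal position with Y'; that is, for every permutation matrix P ≠ I one has ‖P X' − Y'‖ > δ(π(X'), π(Y')) = ‖X' − Y'‖. -/

import Mathlib

/-!
Partition spaces for consensus clustering (Jain, "Condorcet's Jury Theorem for
Consensus Clustering").  Labeled partitions are ℓ×m column-stochastic matrices
with entries in [0,1]; the group Π of ℓ×ℓ permutation matrices acts by left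
multiplication; partitions are orbits; δ is induced by the Frobenius norm.
-/

namespace CJT

/-- ℓ×m real matrices. -/
abbrev Mat (l m : ℕ) := Matrix (Fin l) (Fin m) ℝ

/-- `P` is an ℓ×ℓ permutation matrix. -/
def IsPermMatrix {l : ℕ} (P : Matrix (Fin l) (Fin l) ℝ) : Prop :=
  ∃ σ : Equiv.Perm (Fin l), ∀ i k, P i k = if σ i = k then 1 else 0

/-- `X` is a labeled partition: entries in `[0,1]`, columns summing to one. -/
def IsLabeled {l m : ℕ} (X : Mat l m) : Prop :=
  (∀ i j, 0 ≤ X i j ∧ X i j ≤ 1) ∧ ∀ j, (∑ i, X i j) = 1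

/-- The orbit `[X] = {P X : P ∈ Π}` of a labeled partition. -/
def orbit {l m : ℕ} (X : Mat l m) : Set (Mat l m) :=
  {Y | ∃ P : Matrix (Fin l) (Fin l) ℝ, IsPermMatrix P ∧ Y = P * X}

/-- The partition space 𝒫: all orbits of labeled partitions. -/
def PartitionSpace (l m : ℕ) : Set (Set (Mat l m)) :=
  {A | ∃ X : Mat l m, IsLabeled X ∧ A = orbit X}

/-- Frobenius (Euclidean) norm. -/
noncomputable def frobNorm {l m : ℕ} (X : Mat l m) : ℝ :=
  Real.sqrt (∑ i, ∑ j, (X i j) ^ 2)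

/-- `δ(A, B) = min {‖X' − Y'‖ : X' ∈ A, Y' ∈ B}`. -/
noncomputable def pdist {l m : ℕ} (A B : Set (Mat l m)) : ℝ :=
  sInf {d | ∃ X ∈ A, ∃ Y ∈ B, d = frobNorm (X - Y)}

/-- The degree of asymmetry
`α_Z = min {‖Z' − P Z'‖ : Z' ∈ Z, P ∈ Π, P ≠ I}` of a partition `Z`. -/
noncomputable def asym {l m : ℕ} (A : Set (Mat l m)) : ℝ :=
  sInf {d | ∃ Z' ∈ A, ∃ P : Matrix (Fin l) (Fin l) ℝ,
    IsPermMatrix P ∧ P ≠ 1 ∧ d = frobNorm (Z' - P * Z')}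

attribute [local instance] Matrix.frobeniusNormedAddCommGroup in
theorem frobNorm_eq_norm {l m : ℕ} (X : Mat l m) : frobNorm X = ‖X‖ := by
  simp [frobNorm, Matrix.frobenius_norm_def, Real.sqrt_eq_rpow]

theorem frobNorm_nonneg {l m : ℕ} (X : Mat l m) : 0 ≤ frobNorm X :=
  Real.sqrt_nonneg _

attribute [local instance] Matrix.frobeniusNormedAddCommGroup in
theorem frobNorm_sub_le_frobNorm_sub_add_frobNorm_sub {l m : ℕ} (X Y W : Mat l m) :
    frobNorm (X - W) ≤ frobNorm (X - Y) + frobNorm (Y - W) := by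
  simpa only [frobNorm_eq_norm] using norm_sub_le_norm_sub_add_norm_sub X Y W

attribute [local instance] Matrix.frobeniusNormedAddCommGroup in
theorem frobNorm_sub_rev {l m : ℕ} (X Y : Mat l m) : frobNorm (X - Y) = frobNorm (Y - X) := by
  simpa only [frobNorm_eq_norm] using norm_sub_rev X Y

theorem isPermMatrix_iff_exists_permMatrix {l : ℕ} {P : Matrix (Fin l) (Fin l) ℝ} :
    IsPermMatrix P ↔ ∃ σ : Equiv.Perm (Fin l), P = σ.permMatrix ℝ := by
  simp [IsPermMatrix, ← Matrix.ext_iff, Equiv.Perm.permMatrix, PEquiv.toMatrix_apply, eq_comm]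

theorem isPermMatrix_one {l : ℕ} : IsPermMatrix (1 : Matrix (Fin l) (Fin l) ℝ) :=
  isPermMatrix_iff_exists_permMatrix.2 ⟨1, by simp⟩

theorem IsPermMatrix.mul {l : ℕ} {P Q : Matrix (Fin l) (Fin l) ℝ} (hP : IsPermMatrix P)
    (hQ : IsPermMatrix Q) : IsPermMatrix (P * Q) := by
  rw [isPermMatrix_iff_exists_permMatrix] at *
  obtain ⟨σ, rfl⟩ := hP
  obtain ⟨τ, rfl⟩ := hQ
  exact ⟨τ * σ, by rw [Matrix.permMatrix_mul]⟩

theorem IsPermMatrix.exists_left_inverse {l : ℕ} {P : Matrix (Fin l) (Fin l) ℝ}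
    (hP : IsPermMatrix P) : ∃ Q, IsPermMatrix Q ∧ Q * P = 1 := by
  obtain ⟨σ, rfl⟩ := isPermMatrix_iff_exists_permMatrix.1 hP
  refine ⟨σ⁻¹.permMatrix ℝ, isPermMatrix_iff_exists_permMatrix.2 ⟨_, rfl⟩, ?_⟩
  rw [← Matrix.permMatrix_mul, mul_inv_cancel, Matrix.permMatrix_one]

theorem IsPermMatrix.frobNorm_mul {l m : ℕ} {P : Matrix (Fin l) (Fin l) ℝ}
    (hP : IsPermMatrix P) (X : Mat l m) : frobNorm (P * X) = frobNorm X := by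
  obtain ⟨σ, hσ⟩ := hP
  simp only [frobNorm, Matrix.mul_apply, hσ, ite_mul, one_mul, zero_mul, Finset.sum_ite_eq,
    Finset.mem_univ, if_true]
  rw [Equiv.sum_comp σ fun i => ∑ j, X i j ^ 2]

theorem asym_le {l m : ℕ} {A : Set (Mat l m)} {Z : Mat l m} (hZ : Z ∈ A)
    {P : Matrix (Fin l) (Fin l) ℝ} (hP : IsPermMatrix P) (hP1 : P ≠ 1) :
    asym A ≤ frobNorm (Z - P * Z) := by
  refine csInf_le ⟨0, ?_⟩ ⟨Z, hZ, P, hP, hP1, rfl⟩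
  rintro _ ⟨_, -, _, -, -, rfl⟩
  exact frobNorm_nonneg _

/-- A labeled partition close to `Z` relative to the asymmetry of `Z` is moved away from
nearby labeled partitions by every nontrivial relabeling. -/
theorem frobNorm_sub_lt_frobNorm_mul_sub {l m : ℕ} {A : Set (Mat l m)} {X Y Z : Mat l m}
    (hZ : Z ∈ A) (hX : frobNorm (X - Z) < asym A / 4) (hY : frobNorm (Y - Z) < asym A / 4)
    {P : Matrix (Fin l) (Fin l) ℝ} (hP : IsPermMatrix P) (hP1 : P ≠ 1) :
    frobNorm (X - Y) < frobNorm (P * X - Y) := by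
  have hPX : frobNorm (P * X - P * Z) = frobNorm (X - Z) := by
    rw [← Matrix.mul_sub, hP.frobNorm_mul]
  have h₁ := frobNorm_sub_le_frobNorm_sub_add_frobNorm_sub X Z Y
  have h₂ := frobNorm_sub_le_frobNorm_sub_add_frobNorm_sub Z Y (P * Z)
  have h₃ := frobNorm_sub_le_frobNorm_sub_add_frobNorm_sub Y (P * X) (P * Z)
  have h₄ := asym_le hZ hP hP1
  rw [frobNorm_sub_rev Z Y] at h₁ h₂
  rw [frobNorm_sub_rev Y (P * X)] at h₃
  linarith

/-- If no relabeling of `X` is closer to `Y` than `X` itself, then `X` and `Y` are in optimal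
position. -/
theorem pdist_orbit_eq {l m : ℕ} {X Y : Mat l m}
    (h : ∀ P, IsPermMatrix P → frobNorm (X - Y) ≤ frobNorm (P * X - Y)) :
    pdist (orbit X) (orbit Y) = frobNorm (X - Y) := by
  refine IsLeast.csInf_eq ⟨⟨X, ⟨1, isPermMatrix_one, by simp⟩, Y,
    ⟨1, isPermMatrix_one, by simp⟩, rfl⟩, ?_⟩
  rintro _ ⟨_, ⟨P, hP, rfl⟩, _, ⟨Q, hQ, rfl⟩, rfl⟩
  obtain ⟨R, hR, hRQ⟩ := hQ.exists_left_inverse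
  rw [← hR.frobNorm_mul (P * X - Q * Y), Matrix.mul_sub, ← Matrix.mul_assoc, ← Matrix.mul_assoc, hRQ,
    Matrix.one_mul]
  exact h _ (hR.mul hP)

/-- Let `Z` be an asymmetric partition with representation
`Z'` and let `A°_{Z'} = {X ∈ 𝒳 : ‖X − Z'‖ < α_Z/4}`.  If `X', Y' ∈ A°_{Z'}`,
then `X'` is the unique representation of `π(X')` in optimal position with
`Y'`: `δ(π(X'), π(Y')) = ‖X' − Y'‖`, and `‖P X' − Y'‖ > δ(π(X'), π(Y'))` for
every permutation matrix `P ≠ I`. -/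
theorem unique_optimal_position_in_open_ball (l m : ℕ) (hl : 1 ≤ l) (hm : 1 ≤ m)
    (Z : Set (Mat l m)) (hZ : Z ∈ PartitionSpace l m) (hasym : 0 < asym Z)
    (Z' : Mat l m) (hZ' : Z' ∈ Z)
    (X' Y' : Mat l m) (hX'lab : IsLabeled X') (hY'lab : IsLabeled Y')
    (hX' : frobNorm (X' - Z') < asym Z / 4) (hY' : frobNorm (Y' - Z') < asym Z / 4) :
    pdist (orbit X') (orbit Y') = frobNorm (X' - Y') ∧
    ∀ P : Matrix (Fin l) (Fin l) ℝ, IsPermMatrix P → P ≠ 1 →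
      pdist (orbit X') (orbit Y') < frobNorm (P * X' - Y') := by
  have hlt : ∀ P : Matrix (Fin l) (Fin l) ℝ, IsPermMatrix P → P ≠ 1 →
      frobNorm (X' - Y') < frobNorm (P * X' - Y') := fun P hP hP1 =>
    frobNorm_sub_lt_frobNorm_mul_sub hZ' hX' hY' hP hP1
  have hdist : pdist (orbit X') (orbit Y') = frobNorm (X' - Y') := by
    refine pdist_orbit_eq fun P hP => ?_
    rcases eq_or_ne P 1 with rfl | hP1
    · exact (congrArg (fun W => frobNorm (W - Y')) (Matrix.one_mul X')).ge
    · exact (hlt P hP hP1).le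
  exact ⟨hdist, fun P hP hP1 => hdist ▸ hlt P hP hP1⟩

end CJT
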